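/- Let $W$ be an $\omega$-Stone space, i.e. a second countable, locally compact, Hausdorff, totally disconnected space, and let $R=\mathrm{Co}(W)$ be its Boolean ring of compact open subsets. For $A\in R$ let $(A)=\{C\in R\mid C\subseteq A\}$ and let $[A]$ be the isomorphism class of the Boolean ring $(A)$. Call $A\in R$ pseudo-indecomposable (PI) if $A\neq\emptyset$ and for every $B\in R$ with $B\subseteq A$ either $(B)\cong(A)$ or $(A-B)\cong(A)$, and assume that $W$ is primitive, i.e. that every element of $R$ is a disjoint union of finitely many (possibly zero) PI elements. Let $\mathscr S(W)=\{[A]\mid A\in R\text{ is PI}\}$, with $[A]<[B]$ iff $(A)\times(B)\cong(A)$; this relation is transitive and antisymmetric. Write $p\leqslant q$ if $p<q$ or $p=q$. For $p\in\mathscr S(W)$ let $X_p$ be the set of points of $W$ that have a neighbourhood base of sets $A\in R$ with $[A]=p$, and let $X=\bigcup_p X_p$. The family $\mathscr X(W)=\{X_p\mid p\in\mathscr S(W)\}^*$ (the asterisk indicates that $X$ need not be all of $W$) is the canonical partition. A set $A\in R$ is called $p$-trim if $\{q\mid A\cap X_q\neq\emptyset\}=\{q\mid q\geqslant p\}$ and,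 in case $p\not<p$, also $|A\cap X_p|=1$; it is trim if it is $p$-trim for some $p\in\mathscr S(W)$. Then: 1. $\mathscr X(W)$ is a trim $\mathscr S(W)$-partition of $W$. That is, the sets $X_p$ are nonempty and pairwise disjoint; $X_p'\cap X=\bigcup_{q<p}X_q$ for all $p$, where $X_p'$ is the set of limit points of $X_p$ in $W$; every point of $W$ has a neighbourhood base of trim sets; for each $p$ for which a $p$-trim set exists, every point of $W$ with a neighbourhood base of $p$-trim sets lies in $X_p$; and, for each $p$, every point of $X_p$ has a $p$-trim neighbourhood. 2. The trim sets are exactly the PI elements of $R$. 3. For $A\in R$ and $p\in\mathscr S(W)$, the set $A$ is $p$-trim if and only if $[A]=p$. -/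

import Mathlib

universe u

/-- A PO system: a set with a transitive antisymmetric relation `<`. -/
structure POSystem (P : Type u) : Type u where
  lt : P → P → Prop
  lt_trans : ∀ {a b c}, lt a b → lt b c → lt a c
  lt_antisymm : ∀ {a b}, lt a b → lt b a → a = b

/-- `a ≤ b` iff `a < b` or `a = b`. -/
def POSystem.le {P : Type*} (S : POSystem P) (a b : P) : Prop := S.lt a b ∨ a = b

section Partitions

variable {W : Type*} [TopologicalSpace W] {P : Type*}

/-- The type `T(A)` of a subset `A` with respect to the family `X`. -/
def ptype (X : P → Set W) (A : Set W) : Set P := {p | (A ∩ X p).Nonempty}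

/-- A `P`-partition of `W`: pairwise disjoint nonempty sets `X p`, with union `X`, such that
`(X p)' ∩ X = ⋃_{q < p} X q`. -/
def IsPPartition (S : POSystem P) (X : P → Set W) : Prop :=
  (∀ p, (X p).Nonempty) ∧ (Pairwise fun p q => Disjoint (X p) (X q)) ∧
    ∀ p, derivedSet (X p) ∩ (⋃ q, X q) = ⋃ q ∈ {q : P | S.lt q p}, X q

/-- `A` is a `p`-trim set: compact open, `T(A) = {q | q ≥ p}`, and `|A ∩ X p| = 1` if
`p ∈ P^d`. -/
def IsTrimAt (S : POSystem P) (X : P → Set W) (A : Set W) (p : P) : Prop :=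
  IsCompact A ∧ IsOpen A ∧ ptype X A = {q | S.le p q} ∧
    (¬ S.lt p p → ∃! x, x ∈ A ∩ X p)

/-- `A` is a trim set. -/
def IsTrimSet (S : POSystem P) (X : P → Set W) (A : Set W) : Prop :=
  ∃ p, IsTrimAt S X A p

/-- `P̂`: the set of `p` for which some `p`-trim set exists. -/
def Phat (S : POSystem P) (X : P → Set W) : Set P := {p | ∃ A, IsTrimAt S X A p}

/-- Axiom T1: every point of `W` has a neighbourhood base of trim sets. -/
def HasTrimBases (S : POSystem P) (X : P → Set W) : Prop :=
  ∀ w : W, ∀ U ∈ nhds w, ∃ A, IsTrimSet S X A ∧ w ∈ A ∧ A ⊆ U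

/-- Axiom T2: for `p ∈ P̂`, every point with a neighbourhood base of `p`-trim sets
lies in `X p`. -/
def IsFull (S : POSystem P) (X : P → Set W) : Prop :=
  ∀ p ∈ Phat S X, ∀ w : W,
    (∀ U ∈ nhds w, ∃ A, IsTrimAt S X A p ∧ w ∈ A ∧ A ⊆ U) → w ∈ X p

/-- Axiom T3: all points of `⋃ p, X p` are clean. -/
def AllClean (S : POSystem P) (X : P → Set W) : Prop :=
  ∀ p : P, ∀ w ∈ X p, ∃ A, IsTrimAt S X A p ∧ w ∈ A

/-- A trim `P`-partition. -/
def IsTrimPartition (S : POSystem P) (X : P → Set W) : Prop :=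
  IsPPartition S X ∧ HasTrimBases S X ∧ IsFull S X ∧ AllClean S X

end Partitions

section Primitive

variable {W : Type*} [TopologicalSpace W]

/-- The ideal `(A)` of the Boolean ring of compact open sets: the compact open subsets
of `A`. -/
def coIdeal (A : Set W) : Set (Set W) := {C | IsCompact C ∧ IsOpen C ∧ C ⊆ A}

/-- `(A) ≅ (B)`. Isomorphisms of Boolean rings are the same as isomorphisms of the
underlying partial orders (inclusion). -/
def IdealIso (A B : Set W) : Prop := Nonempty (↥(coIdeal A) ≃o ↥(coIdeal B))

/-- `(A) × (B) ≅ (A)`. -/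
def ProdIdealIso (A B : Set W) : Prop :=
  Nonempty ((↥(coIdeal A) × ↥(coIdeal B)) ≃o ↥(coIdeal A))

/-- A compact open set `A` is pseudo-indecomposable (PI): it is nonzero, and for each
compact open `B ⊆ A`, `(B) ≅ (A)` or `(A - B) ≅ (A)`. -/
def IsPISet (A : Set W) : Prop :=
  IsCompact A ∧ IsOpen A ∧ A.Nonempty ∧ ∀ B : Set W, IsCompact B → IsOpen B → B ⊆ A →
    IdealIso B A ∨ IdealIso (A \ B) A

/-- `W` is primitive: every compact open set is a finite (possibly empty) disjoint union of
PI sets. -/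
def PrimitiveSpace (W : Type*) [TopologicalSpace W] : Prop :=
  ∀ A : Set W, IsCompact A → IsOpen A →
    ∃ (n : ℕ) (F : Fin n → Set W), (∀ i, IsPISet (F i)) ∧
      (Pairwise fun i j => Disjoint (F i) (F j)) ∧ A = ⋃ i, F i

/-- The setoid of PI sets up to isomorphism of their ideals. -/
def piIsoSetoid (W : Type*) [TopologicalSpace W] : Setoid {A : Set W // IsPISet A} where
  r A B := IdealIso A.1 B.1
  iseqv := ⟨fun _ => ⟨OrderIso.refl _⟩,
    fun h => h.elim fun e => ⟨e.symm⟩,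
    fun h1 h2 => h1.elim fun e => h2.elim fun f => ⟨e.trans f⟩⟩

/-- The underlying set of the structure diagram `𝒮(W)`: isomorphism classes of ideals `(A)`
of PI sets `A`. -/
def SDiagram (W : Type*) [TopologicalSpace W] : Type _ := Quotient (piIsoSetoid W)

/-- The relation on `𝒮(W)`: `[A] < [B]` iff `(A) × (B) ≅ (A)`. -/
def SDiagramLt {W : Type*} [TopologicalSpace W] (x y : SDiagram W) : Prop :=
  ∃ A B : {A : Set W // IsPISet A}, x = Quotient.mk (piIsoSetoid W) A ∧
    y = Quotient.mk (piIsoSetoid W) B ∧ ProdIdealIso A.1 B.1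

/-- The product of two order isomorphisms. -/
def orderIsoProd {α β γ δ : Type*} [Preorder α] [Preorder β] [Preorder γ] [Preorder δ]
    (f : α ≃o γ) (g : β ≃o δ) : (α × β) ≃o (γ × δ) where
  toEquiv := f.toEquiv.prodCongr g.toEquiv
  map_rel_iff' := by
    intro a b
    simp [Prod.le_def]

/-- The relation does not depend on the chosen representatives. -/
theorem SDiagramLt_mk (A B : {A : Set W // IsPISet A}) :
    SDiagramLt (Quotient.mk (piIsoSetoid W) A) (Quotient.mk (piIsoSetoid W) B) ↔
      ProdIdealIso A.1 B.1 := by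
  constructor
  · rintro ⟨A', B', hA, hB, ⟨e⟩⟩
    obtain ⟨f⟩ : IdealIso A.1 A'.1 := Quotient.exact hA
    obtain ⟨g⟩ : IdealIso B.1 B'.1 := Quotient.exact hB
    exact ⟨((orderIsoProd f g).trans e).trans f.symm⟩
  · intro h
    exact ⟨A, B, rfl, rfl, h⟩

/-- The structure diagram `𝒮(W)` as a PO system. -/
def structureDiagram (W : Type*) [TopologicalSpace W] : POSystem (SDiagram W) where
  lt := SDiagramLt
  lt_trans := by
    intro a b c
    induction a using Quotient.inductionOn with | _ A
    induction b using Quotient.inductionOn with | _ B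
    induction c using Quotient.inductionOn with | _ C
    intro h1 h2
    obtain ⟨e⟩ := (SDiagramLt_mk A B).1 h1
    obtain ⟨f⟩ := (SDiagramLt_mk B C).1 h2
    exact (SDiagramLt_mk A C).2
      ⟨(((orderIsoProd e.symm (OrderIso.refl _)).trans (OrderIso.prodAssoc _ _ _)).trans
        (orderIsoProd (OrderIso.refl _) f)).trans e⟩
  lt_antisymm := by
    intro a b
    induction a using Quotient.inductionOn with | _ A
    induction b using Quotient.inductionOn with | _ B
    intro h1 h2
    obtain ⟨e⟩ := (SDiagramLt_mk A B).1 h1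
    obtain ⟨f⟩ := (SDiagramLt_mk B A).1 h2
    exact Quotient.sound ⟨(e.symm.trans OrderIso.prodComm).trans f⟩

/-- `[A] = p`, for a set `A` and `p ∈ 𝒮(W)`; as every `p ∈ 𝒮(W)` is the class of a PI set,
this entails that `A` is PI. -/
def HasClass (A : Set W) (p : SDiagram W) : Prop :=
  ∃ h : IsPISet A, Quotient.mk (piIsoSetoid W) ⟨A, h⟩ = p

/-- The blocks `X_p` of the canonical partition `𝒳(W)`: the points having a neighbourhood
base of compact open sets of class `p`. -/
def canonicalBlock (W : Type*) [TopologicalSpace W] (p : SDiagram W) : Set W :=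
  {w | ∀ U ∈ nhds w, ∃ A : Set W, HasClass A p ∧ w ∈ A ∧ A ⊆ U}

end Primitive

section CompactOpenIdeals

variable {W : Type*} [TopologicalSpace W]

theorem self_mem_coIdeal {A : Set W} (hc : IsCompact A) (ho : IsOpen A) : A ∈ coIdeal A :=
  ⟨hc, ho, subset_rfl⟩

theorem empty_mem_coIdeal (A : Set W) : ∅ ∈ coIdeal A :=
  ⟨isCompact_empty, isOpen_empty, Set.empty_subset _⟩

theorem IdealIso.symm {A B : Set W} (h : IdealIso A B) : IdealIso B A :=
  h.elim fun e => ⟨e.symm⟩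

theorem IdealIso.trans {A B C : Set W} (h : IdealIso A B) (h' : IdealIso B C) : IdealIso A C :=
  h.elim fun e => h'.elim fun f => ⟨e.trans f⟩

theorem idealIso_of_orderEmbedding {A C : Set W} (f : coIdeal C ↪o coIdeal A) (T : coIdeal A)
    (h : ∀ D, D ≤ T ↔ ∃ c, f c = D) : IdealIso C T.1 := by
  let g : coIdeal C ↪o coIdeal T.1 := OrderEmbedding.ofMapLEIff
    (fun c => ⟨(f c).1, (f c).2.1, (f c).2.2.1, (h (f c)).2 ⟨c, rfl⟩⟩)
    (fun a b => f.le_iff_le (a := a) (b := b))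
  refine ⟨RelIso.ofSurjective g fun D => ?_⟩
  obtain ⟨c, hc⟩ := (h ⟨D.1, D.2.1, D.2.2.1, D.2.2.2.trans T.2.2.2⟩).1 D.2.2.2
  have hc' : (f c).1 = D.1 := by rw [hc]
  exact ⟨c, Subtype.ext hc'⟩

/-- An order isomorphism of ideals restricts to the ideal of an element. -/
theorem idealIso_apply {A B : Set W} (e : coIdeal A ≃o coIdeal B) (C : coIdeal A) :
    IdealIso C.1 (e C).1 := by
  refine idealIso_of_orderEmbedding (OrderEmbedding.ofMapLEIff
    (fun D => e ⟨D.1, D.2.1, D.2.2.1, D.2.2.2.trans C.2.2.2⟩) fun D D' => ?_) _ fun D => ?_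
  · rw [e.le_iff_le]
    rfl
  · rw [← e.symm_apply_le]
    refine ⟨fun h => ⟨⟨_, (e.symm D).2.1, (e.symm D).2.2.1, h⟩, e.apply_symm_apply D⟩, ?_⟩
    rintro ⟨c, rfl⟩
    exact e.symm_apply_le.2 (e.monotone c.2.2.2)

theorem coe_apply_empty {A B : Set W} (e : coIdeal A ≃o coIdeal B) :
    (e ⟨∅, empty_mem_coIdeal A⟩).1 = ∅ := by
  have h : e ⟨∅, empty_mem_coIdeal A⟩ ≤ ⟨∅, empty_mem_coIdeal B⟩ := by
    rw [← e.le_symm_apply]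
    exact Set.empty_subset _
  exact Set.subset_empty_iff.1 h

theorem coe_apply_self {A B : Set W} (e : coIdeal A ≃o coIdeal B) (hA : A ∈ coIdeal A)
    (hB : B ∈ coIdeal B) : (e ⟨A, hA⟩).1 = B := by
  refine (e ⟨A, hA⟩).2.2.2.antisymm ?_
  have h : (⟨B, hB⟩ : coIdeal B) ≤ e ⟨A, hA⟩ := by
    rw [← e.symm_apply_le]
    exact (e.symm ⟨B, hB⟩).2.2.2
  exact h

variable [T2Space W]

theorem disjoint_apply {A B : Set W} (e : coIdeal A ≃o coIdeal B) {C D : coIdeal A}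
    (h : Disjoint C.1 D.1) : Disjoint (e C).1 (e D).1 := by
  let I : coIdeal B := ⟨(e C).1 ∩ (e D).1, (e C).2.1.inter (e D).2.1,
    (e C).2.2.1.inter (e D).2.2.1, Set.inter_subset_left.trans (e C).2.2.2⟩
  have hC : e.symm I ≤ C := e.symm_apply_le.2 (show I.1 ⊆ _ from Set.inter_subset_left)
  have hD : e.symm I ≤ D := e.symm_apply_le.2 (show I.1 ⊆ _ from Set.inter_subset_right)
  have hI : e.symm I ≤ ⟨∅, empty_mem_coIdeal A⟩ :=
    show (e.symm I).1 ⊆ ∅ from fun x hx => Set.disjoint_left.1 h (hC hx) (hD hx)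
  have : I ≤ e ⟨∅, empty_mem_coIdeal A⟩ := e.symm_apply_le.1 hI
  rw [Set.disjoint_iff]
  intro x hx
  rw [← coe_apply_empty e]
  exact this hx

theorem coe_apply_diff {A B : Set W} (e : coIdeal A ≃o coIdeal B) (hA : IsCompact A)
    (hA' : IsOpen A) (hB : IsCompact B) (hB' : IsOpen B) (C : coIdeal A) :
    (e ⟨A \ C.1, hA.diff C.2.2.1, hA'.sdiff C.2.1.isClosed, Set.sdiff_subset⟩).1
      = B \ (e C).1 := by
  apply Set.Subset.antisymm
  · refine Set.subset_sdiff.2 ⟨(e _).2.2.2, disjoint_apply e ?_⟩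
    exact Set.disjoint_sdiff_left
  · let D : coIdeal B := ⟨B \ (e C).1, hB.diff (e C).2.2.1, hB'.sdiff (e C).2.1.isClosed,
      Set.sdiff_subset⟩
    have h : Disjoint (e.symm D).1 C.1 := by
      have := disjoint_apply e.symm (C := D) (D := e C) Set.disjoint_sdiff_left
      rwa [e.symm_apply_apply] at this
    have h' : e.symm D ≤ ⟨A \ C.1, hA.diff C.2.2.1, hA'.sdiff C.2.1.isClosed,
        Set.sdiff_subset⟩ :=
      show (e.symm D).1 ⊆ A \ C.1 from Set.subset_sdiff.2 ⟨(e.symm D).2.2.2, h⟩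
    exact e.symm_apply_le.1 h'

/-- Pseudo-indecomposability is invariant under isomorphism of ideals. -/
theorem IsPISet.of_idealIso {A B : Set W} (hA : IsPISet A) (hB : IsCompact B)
    (hB' : IsOpen B) (h : IdealIso A B) : IsPISet B := by
  obtain ⟨e⟩ := h
  obtain ⟨hc, ho, hne, hpi⟩ := hA
  refine ⟨hB, hB', ?_, ?_⟩
  · rw [Set.nonempty_iff_ne_empty]
    rintro rfl
    have h := coe_apply_self e.symm (empty_mem_coIdeal ∅) (self_mem_coIdeal hc ho)
    rw [coe_apply_empty] at h
    exact hne.ne_empty h.symm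
  · intro C hC hC' hCB
    let D : coIdeal B := ⟨C, hC, hC', hCB⟩
    have hD : IdealIso C (e.symm D).1 := idealIso_apply e.symm D
    have hD' : IdealIso (B \ C) (A \ (e.symm D).1) := by
      have := idealIso_apply e.symm
        ⟨B \ D.1, hB.diff D.2.2.1, hB'.sdiff D.2.1.isClosed, Set.sdiff_subset⟩
      rwa [coe_apply_diff e.symm hB hB' hc ho D] at this
    exact (hpi _ (e.symm D).2.1 (e.symm D).2.2.1 (e.symm D).2.2.2).imp
      (fun h => (hD.trans h).trans ⟨e⟩) (fun h => (hD'.trans h).trans ⟨e⟩)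

/-- The ideal of a disjoint union is the product of the ideals. -/
def coIdealUnion {A B : Set W} (hA : IsCompact A) (hA' : IsOpen A) (hB : IsCompact B)
    (hB' : IsOpen B) (h : Disjoint A B) : coIdeal (A ∪ B) ≃o coIdeal A × coIdeal B where
  toFun C := (⟨C.1 ∩ A, C.2.1.inter hA, C.2.2.1.inter hA', Set.inter_subset_right⟩,
    ⟨C.1 ∩ B, C.2.1.inter hB, C.2.2.1.inter hB', Set.inter_subset_right⟩)
  invFun D := ⟨D.1.1 ∪ D.2.1, D.1.2.1.union D.2.2.1, D.1.2.2.1.union D.2.2.2.1,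
    Set.union_subset_union D.1.2.2.2 D.2.2.2.2⟩
  left_inv C := Subtype.ext <| by
    change C.1 ∩ A ∪ C.1 ∩ B = C.1
    rw [← Set.inter_union_distrib_left, Set.inter_eq_left.2 C.2.2.2]
  right_inv D := by
    obtain ⟨⟨C, _, _, hC⟩, ⟨D, _, _, hD⟩⟩ := D
    refine Prod.ext (Subtype.ext ?_) (Subtype.ext ?_)
    · change (C ∪ D) ∩ A = C
      rw [Set.union_inter_distrib_right, Set.inter_eq_left.2 hC,
        (h.symm.mono_left hD).inter_eq, Set.union_empty]
    · change (C ∪ D) ∩ B = D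
      rw [Set.union_inter_distrib_right, Set.inter_eq_left.2 hD,
        (h.mono_left hC).inter_eq, Set.empty_union]
  map_rel_iff' {C D} := by
    constructor
    · rintro ⟨h₁, h₂⟩ x hx
      rcases C.2.2.2 hx with hxA | hxB
      · exact (h₁ ⟨hx, hxA⟩ : x ∈ D.1 ∩ A).1
      · exact (h₂ ⟨hx, hxB⟩ : x ∈ D.1 ∩ B).1
    · intro h
      exact ⟨Set.inter_subset_inter_left A h, Set.inter_subset_inter_left B h⟩

end CompactOpenIdeals

section Classes

variable {W : Type*} [TopologicalSpace W] {p q : SDiagram W} {A B : Set W}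

theorem HasClass.isPISet (h : HasClass A p) : IsPISet A := h.1

theorem HasClass.isCompact (h : HasClass A p) : IsCompact A := h.1.1

theorem HasClass.isOpen (h : HasClass A p) : IsOpen A := h.1.2.1

theorem HasClass.nonempty (h : HasClass A p) : A.Nonempty := h.1.2.2.1

theorem exists_hasClass (p : SDiagram W) : ∃ A, HasClass A p := by
  induction p using Quotient.inductionOn with | _ A
  exact ⟨A.1, A.2, rfl⟩

theorem IsPISet.exists_hasClass (h : IsPISet A) : ∃ p, HasClass A p := ⟨_, h, rfl⟩

theorem HasClass.idealIso (hA : HasClass A p) (hB : HasClass B p) : IdealIso A B := by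
  obtain ⟨hA, rfl⟩ := hA
  obtain ⟨hB, h⟩ := hB
  exact IdealIso.symm (Quotient.exact h)

theorem HasClass.eq_of_idealIso (hA : HasClass A p) (hB : HasClass B q) (h : IdealIso A B) :
    p = q := by
  obtain ⟨hA, rfl⟩ := hA
  obtain ⟨hB, rfl⟩ := hB
  exact Quotient.sound h

theorem HasClass.lt_iff (hA : HasClass A p) (hB : HasClass B q) :
    (structureDiagram W).lt p q ↔ ProdIdealIso A B := by
  obtain ⟨hA, rfl⟩ := hA
  obtain ⟨hB, rfl⟩ := hB
  exact SDiagramLt_mk _ _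

theorem structureDiagram_le_antisymm (h : (structureDiagram W).le p q)
    (h' : (structureDiagram W).le q p) : p = q := by
  rcases h with h | h
  · rcases h' with h' | h'
    · exact (structureDiagram W).lt_antisymm h h'
    · exact h'.symm
  · exact h

variable [T2Space W]

theorem HasClass.of_idealIso (hA : HasClass A p) (hB : IsCompact B) (hB' : IsOpen B)
    (h : IdealIso A B) : HasClass B p := by
  have hpi := hA.isPISet.of_idealIso hB hB' h
  exact ⟨hpi, (HasClass.eq_of_idealIso hA ⟨hpi, rfl⟩ h).symm⟩

theorem HasClass.le_of_subset (hA : HasClass A p) (hB : HasClass B q) (h : B ⊆ A) :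
    (structureDiagram W).le p q := by
  rcases hA.isPISet.2.2.2 B hB.isCompact hB.isOpen h with h' | ⟨⟨e⟩⟩
  · exact Or.inr (hA.eq_of_idealIso hB h'.symm)
  · left
    rw [hA.lt_iff hB]
    let f := coIdealUnion (hA.isCompact.diff hB.isOpen) (hA.isOpen.sdiff hB.isCompact.isClosed)
      hB.isCompact hB.isOpen Set.disjoint_sdiff_left
    rw [Set.sdiff_union_of_subset h] at f
    exact ⟨(orderIsoProd e.symm (OrderIso.refl _)).trans f.symm⟩

theorem HasClass.union_of_lt (hA : HasClass A p) (hB : HasClass B q)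
    (hpq : (structureDiagram W).lt p q) (h : Disjoint A B) : HasClass (A ∪ B) p := by
  obtain ⟨e⟩ := (hA.lt_iff hB).1 hpq
  exact hA.of_idealIso (hA.isCompact.union hB.isCompact) (hA.isOpen.union hB.isOpen)
    ⟨((coIdealUnion hA.isCompact hA.isOpen hB.isCompact hB.isOpen h).trans e).symm⟩

theorem HasClass.lt_of_union (hA : HasClass A p) (hB : HasClass B q)
    (h : Disjoint A B) (hAB : IdealIso (A ∪ B) A) : (structureDiagram W).lt p q := by
  obtain ⟨e⟩ := hAB
  exact (hA.lt_iff hB).2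
    ⟨(coIdealUnion hA.isCompact hA.isOpen hB.isCompact hB.isOpen h).symm.trans e⟩

/-- A set isomorphic to `A` contains copies of everything contained in `A`. -/
theorem HasClass.exists_disjoint_subsets (hA : HasClass A p) (hB : HasClass B p)
    {U V : Set W} {r s : SDiagram W} (hU : HasClass U r) (hV : HasClass V s) (hUA : U ⊆ A)
    (hVA : V ⊆ A) (h : Disjoint U V) :
    ∃ U' V', HasClass U' r ∧ HasClass V' s ∧ U' ⊆ B ∧ V' ⊆ B ∧ Disjoint U' V' := by
  obtain ⟨e⟩ := hA.idealIso hB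
  let u : coIdeal A := ⟨U, hU.isCompact, hU.isOpen, hUA⟩
  let v : coIdeal A := ⟨V, hV.isCompact, hV.isOpen, hVA⟩
  exact ⟨(e u).1, (e v).1, hU.of_idealIso (e u).2.1 (e u).2.2.1 (idealIso_apply e u),
    hV.of_idealIso (e v).2.1 (e v).2.2.1 (idealIso_apply e v), (e u).2.2.2, (e v).2.2.2,
    disjoint_apply e h⟩

theorem HasClass.exists_disjoint_of_lt (hA : HasClass A p)
    (hpq : (structureDiagram W).lt p q) :
    ∃ U V, HasClass U p ∧ HasClass V q ∧ U ⊆ A ∧ V ⊆ A ∧ Disjoint U V := by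
  obtain ⟨B, hB⟩ := exists_hasClass q
  obtain ⟨e⟩ := (hA.lt_iff hB).1 hpq
  let a : coIdeal A := ⟨A, self_mem_coIdeal hA.isCompact hA.isOpen⟩
  let a₀ : coIdeal A := ⟨∅, empty_mem_coIdeal A⟩
  let b : coIdeal B := ⟨B, self_mem_coIdeal hB.isCompact hB.isOpen⟩
  let b₀ : coIdeal B := ⟨∅, empty_mem_coIdeal B⟩
  have hd : Disjoint (e (a, b₀)).1 (e (a₀, b)).1 := by
    let I : coIdeal A := ⟨(e (a, b₀)).1 ∩ (e (a₀, b)).1, (e _).2.1.inter (e _).2.1,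
      (e _).2.2.1.inter (e _).2.2.1, Set.inter_subset_left.trans (e _).2.2.2⟩
    have h₁ : e.symm I ≤ (a, b₀) :=
      e.symm_apply_le.2 (show I.1 ⊆ _ from Set.inter_subset_left)
    have h₂ : e.symm I ≤ (a₀, b) :=
      e.symm_apply_le.2 (show I.1 ⊆ _ from Set.inter_subset_right)
    have h₃ : e.symm I ≤ e.symm a₀ :=
      ⟨fun _ hx => ((h₂.1 hx : _ ∈ (∅ : Set W))).elim,
        fun _ hx => ((h₁.2 hx : _ ∈ (∅ : Set W))).elim⟩
    rw [Set.disjoint_iff]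
    exact e.symm.le_iff_le.1 h₃
  have hU : IdealIso A (e (a, b₀)).1 := by
    refine idealIso_of_orderEmbedding
      (OrderEmbedding.ofMapLEIff (fun c => e (c, b₀)) fun c d => ?_) _ fun D => ?_
    · simp [Prod.le_def]
    · rw [← e.symm_apply_le]
      refine ⟨fun h => ⟨(e.symm D).1, ?_⟩, ?_⟩
      · have : (e.symm D).2 = b₀ := Subtype.ext (Set.subset_empty_iff.1 h.2)
        change e ((e.symm D).1, b₀) = D
        rw [← this]
        exact e.apply_symm_apply D
      · rintro ⟨c, rfl⟩
        change e.symm (e (c, b₀)) ≤ _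
        rw [e.symm_apply_apply]
        exact ⟨c.2.2.2, le_rfl⟩
  have hV : IdealIso B (e (a₀, b)).1 := by
    refine idealIso_of_orderEmbedding
      (OrderEmbedding.ofMapLEIff (fun c => e (a₀, c)) fun c d => ?_) _ fun D => ?_
    · simp [Prod.le_def]
    · rw [← e.symm_apply_le]
      refine ⟨fun h => ⟨(e.symm D).2, ?_⟩, ?_⟩
      · have : (e.symm D).1 = a₀ := Subtype.ext (Set.subset_empty_iff.1 h.1)
        change e (a₀, (e.symm D).2) = D
        rw [← this]
        exact e.apply_symm_apply D
      · rintro ⟨c, rfl⟩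
        change e.symm (e (a₀, c)) ≤ _
        rw [e.symm_apply_apply]
        exact ⟨le_rfl, c.2.2.2⟩
  exact ⟨_, _, hA.of_idealIso (e _).2.1 (e _).2.2.1 hU, hB.of_idealIso (e _).2.1 (e _).2.2.1 hV,
    (e _).2.2.2, (e _).2.2.2, hd⟩

end Classes

section Points

variable {W : Type*} [TopologicalSpace W] [T2Space W] {p q : SDiagram W} {A B : Set W}

/-- If a set of class `p` is covered by finitely many compact open sets, then one of them
contains a set of class `p`. -/
theorem HasClass.exists_subset_of_cover {ι : Type*} {D : ι → Set W} (hD : ∀ i, IsCompact (D i))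
    (hD' : ∀ i, IsOpen (D i)) (s : Finset ι) :
    ∀ {V : Set W}, HasClass V p → V ⊆ ⋃ i ∈ s, D i → ∃ i ∈ s, ∃ V' ⊆ D i, HasClass V' p := by
  classical
  induction s using Finset.induction_on with
  | empty =>
    intro V hV h
    obtain ⟨x, hx⟩ := hV.nonempty
    simpa using h hx
  | insert i s _ ih =>
    intro V hV h
    have hc := hV.isCompact.inter (hD i)
    have ho := hV.isOpen.inter (hD' i)
    rcases hV.isPISet.2.2.2 (V ∩ D i) hc ho Set.inter_subset_left with h' | h'
    · exact ⟨i, Finset.mem_insert_self _ _, V ∩ D i, Set.inter_subset_right,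
        hV.of_idealIso hc ho h'.symm⟩
    · have hV' := hV.of_idealIso (hV.isCompact.diff ho) (hV.isOpen.sdiff hc.isClosed) h'.symm
      obtain ⟨j, hj, V', h₁, h₂⟩ := ih hV' (by
        rintro x ⟨hx, hxi⟩
        have := h hx
        simp only [Finset.mem_insert, Set.iUnion_iUnion_eq_or_left, Set.mem_union] at this
        exact this.resolve_left fun h => hxi ⟨hx, h⟩)
      exact ⟨j, Finset.mem_insert_of_mem hj, V', h₁, h₂⟩

/-- A set of class `p` absorbs finitely many disjoint sets of larger class. -/
theorem HasClass.union_biUnion {ι : Type*} {F : ι → Set W} {c : ι → SDiagram W}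
    (hF : ∀ i, HasClass (F i) (c i)) (hd : Pairwise fun i j => Disjoint (F i) (F j))
    (hA : HasClass A p) (s : Finset ι) :
    (∀ i ∈ s, (structureDiagram W).lt p (c i)) → (∀ i ∈ s, Disjoint A (F i)) →
      HasClass (A ∪ ⋃ i ∈ s, F i) p := by
  classical
  induction s using Finset.induction_on with
  | empty => simpa using hA
  | insert i s hi ih =>
    intro hlt hdis
    have h := ih (fun j hj => hlt j (Finset.mem_insert_of_mem hj))
      (fun j hj => hdis j (Finset.mem_insert_of_mem hj))
    have h' := h.union_of_lt (hF i) (hlt i (Finset.mem_insert_self _ _)) (by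
      rw [Set.disjoint_union_left]
      refine ⟨hdis i (Finset.mem_insert_self _ _), ?_⟩
      simp only [Set.disjoint_iUnion_left]
      exact fun j hj => hd fun hji => hi (hji ▸ hj))
    convert h' using 1
    rw [Finset.set_biUnion_insert, Set.union_assoc, Set.union_comm (F i)]

theorem HasClass.le_of_mem_block {x : W} (hA : HasClass A p) (hx : x ∈ A)
    (hq : x ∈ canonicalBlock W q) : (structureDiagram W).le p q := by
  obtain ⟨B, hB, -, hBA⟩ := hq A (hA.isOpen.mem_nhds hx)
  exact hA.le_of_subset hB hBA

variable [LocallyCompactSpace W] [TotallyDisconnectedSpace W]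

theorem exists_isCompact_isOpen_subset {x : W} {U : Set W} (hU : U ∈ nhds x) :
    ∃ V, IsCompact V ∧ IsOpen V ∧ x ∈ V ∧ V ⊆ U := by
  obtain ⟨K, hK, hKU, hKc⟩ := local_compact_nhds hU
  obtain ⟨V, hV, hxV, hVK⟩ := loc_compact_Haus_tot_disc_of_zero_dim.mem_nhds_iff.1 hK
  exact ⟨V, hKc.of_isClosed_subset hV.1 hVK, hV.2, hxV, hVK.trans hKU⟩

theorem isTopologicalBasis_isCompact_isOpen :
    TopologicalSpace.IsTopologicalBasis {V : Set W | IsCompact V ∧ IsOpen V} :=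
  TopologicalSpace.isTopologicalBasis_of_isOpen_of_nhds (fun _ h => h.2) fun _ _ hx hU =>
    let ⟨V, hc, ho, hxV, hVU⟩ := exists_isCompact_isOpen_subset (hU.mem_nhds hx)
    ⟨V, ⟨hc, ho⟩, hxV, hVU⟩

variable [SecondCountableTopology W]

theorem HasClass.exists_mem_block (hA : HasClass A p) : ∃ x ∈ A, x ∈ canonicalBlock W p := by
  classical
  obtain ⟨b, hbV, hbc, hb⟩ :=
    (isTopologicalBasis_isCompact_isOpen (W := W)).exists_countable
  obtain ⟨a, -⟩ := hA.nonempty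
  obtain ⟨s, hs, -⟩ := hb.exists_subset_of_mem_open (Set.mem_univ a) isOpen_univ
  obtain ⟨C, rfl⟩ := hbc.exists_eq_range ⟨s, hs⟩
  have hC n : IsCompact (C n) ∧ IsOpen (C n) := hbV ⟨n, rfl⟩
  have step (n : ℕ) (B : {B : Set W // HasClass B p}) :
      ∃ B' : {B : Set W // HasClass B p}, B'.1 ⊆ B.1 ∧ (B'.1 ⊆ C n ∨ Disjoint B'.1 (C n)) := by
    obtain ⟨B, hB⟩ := B
    have hc := hB.isCompact.inter (hC n).1
    have ho := hB.isOpen.inter (hC n).2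
    rcases hB.isPISet.2.2.2 (B ∩ C n) hc ho Set.inter_subset_left with h | h
    · exact ⟨⟨B ∩ C n, hB.of_idealIso hc ho h.symm⟩, Set.inter_subset_left,
        Or.inl Set.inter_subset_right⟩
    · refine ⟨⟨B \ (B ∩ C n), hB.of_idealIso (hB.isCompact.diff ho)
        (hB.isOpen.sdiff hc.isClosed) h.symm⟩, Set.sdiff_subset, Or.inr ?_⟩
      rw [Set.disjoint_left]
      exact fun x hx hx' => hx.2 ⟨hx.1, hx'⟩
  choose f hf hf' using step
  let S : ℕ → {B : Set W // HasClass B p} := fun n => Nat.rec ⟨A, hA⟩ f n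
  obtain ⟨x, hx⟩ := IsCompact.nonempty_iInter_of_sequence_nonempty_isCompact_isClosed
    (fun n => (S n).1) (fun n => hf n (S n)) (fun n => (S n).2.nonempty) hA.isCompact
    (fun n => (S n).2.isCompact.isClosed)
  rw [Set.mem_iInter] at hx
  refine ⟨x, hx 0, fun U hU => ?_⟩
  obtain ⟨_, ⟨n, rfl⟩, hxC, hCU⟩ := hb.mem_nhds_iff.1 hU
  refine ⟨(S (n + 1)).1, (S (n + 1)).2, hx (n + 1), ?_⟩
  rcases hf' n (S n) with h | h
  · exact h.trans hCU
  · exact (Set.disjoint_left.1 h (hx (n + 1)) hxC).elim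

end Points

section Gluing

variable {W : Type*} [TopologicalSpace W] {ι : Type*}

/-- `A` is compact open and `A \ {x}` is the disjoint union of the compact open sets `E i`. -/
structure IsPointedDecomp (A : Set W) (x : W) (E : ι → Set W) : Prop where
  isCompact : IsCompact A
  isOpen : IsOpen A
  mem : x ∈ A
  isCompact_part : ∀ i, IsCompact (E i)
  isOpen_part : ∀ i, IsOpen (E i)
  disjoint : Pairwise fun i j => Disjoint (E i) (E j)
  diff_eq : A \ {x} = ⋃ i, E i

variable {A B : Set W} {x y : W} {E F : ι → Set W}

theorem IsPointedDecomp.part_subset (hA : IsPointedDecomp A x E) (i : ι) : E i ⊆ A :=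
  ((Set.subset_iUnion E i).trans hA.diff_eq.ge).trans Set.sdiff_subset

theorem IsPointedDecomp.notMem_part (hA : IsPointedDecomp A x E) (i : ι) : x ∉ E i := fun h =>
  (hA.diff_eq.ge (Set.mem_iUnion_of_mem i h)).2 rfl

theorem IsPointedDecomp.eq_or_exists (hA : IsPointedDecomp A x E) {z : W} (hz : z ∈ A) :
    z = x ∨ ∃ i, z ∈ E i := by
  by_cases h : z = x
  · exact Or.inl h
  · exact Or.inr (Set.mem_iUnion.1 (hA.diff_eq.le ⟨hz, h⟩))

/-- A compact subset of `A \ {x}` meets only finitely many parts. -/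
theorem IsPointedDecomp.finite_inter (hA : IsPointedDecomp A x E) {K : Set W}
    (hK : IsCompact K) (hKA : K ⊆ A) (hx : x ∉ K) : {i | (K ∩ E i).Nonempty}.Finite := by
  obtain ⟨t, ht⟩ := hK.elim_finite_subcover E hA.isOpen_part fun z hz =>
    hA.diff_eq.le ⟨hKA hz, fun h => hx (h ▸ hz)⟩
  refine t.finite_toSet.subset ?_
  rintro i ⟨z, hz, hzi⟩
  obtain ⟨j, hj, hzj⟩ := Set.mem_iUnion₂.1 (ht hz)
  by_contra hi
  have hij : i ≠ j := fun h => hi (h ▸ hj)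
  exact Set.disjoint_left.1 (hA.disjoint hij) hzi hzj

theorem IsPointedDecomp.reindex {κ : Type*} (hA : IsPointedDecomp A x E) (σ : κ ≃ ι) :
    IsPointedDecomp A x (E ∘ σ) where
  isCompact := hA.isCompact
  isOpen := hA.isOpen
  mem := hA.mem
  isCompact_part i := hA.isCompact_part (σ i)
  isOpen_part i := hA.isOpen_part (σ i)
  disjoint _ _ h := hA.disjoint (σ.injective.ne h)
  diff_eq := hA.diff_eq.trans (σ.surjective.iUnion_comp E).symm

/-- Adjoining one more part. -/
theorem IsPointedDecomp.union {V : Set W} (hA : IsPointedDecomp A x E) (hV : IsCompact V)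
    (hV' : IsOpen V) (h : Disjoint A V) :
    IsPointedDecomp (A ∪ V) x (fun i : Option ι => i.elim V E) where
  isCompact := hA.isCompact.union hV
  isOpen := hA.isOpen.union hV'
  mem := Or.inl hA.mem
  isCompact_part i := by cases i; exacts [hV, hA.isCompact_part _]
  isOpen_part i := by cases i; exacts [hV', hA.isOpen_part _]
  disjoint i j hij := by
    cases i <;> cases j
    · exact (hij rfl).elim
    · exact (h.mono_left (hA.part_subset _)).symm
    · exact h.mono_left (hA.part_subset _)
    · exact hA.disjoint fun h => hij (congrArg some h)
  diff_eq := by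
    rw [Set.iUnion_option, Set.union_sdiff_distrib, hA.diff_eq, Set.union_comm,
      Set.sdiff_singleton_eq_self (Set.disjoint_left.1 h hA.mem)]
    rfl

variable [T2Space W]

/-- The part of `C` in `E i`. -/
def IsPointedDecomp.part (hA : IsPointedDecomp A x E) (C : coIdeal A) (i : ι) : coIdeal (E i) :=
  ⟨C.1 ∩ E i, C.2.1.inter (hA.isCompact_part i), C.2.2.1.inter (hA.isOpen_part i),
    Set.inter_subset_right⟩

/-- The image of `C` under the map glued from the `e i` and `x ↦ y`. -/
def IsPointedDecomp.glueSet (hA : IsPointedDecomp A x E) (y : W)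
    (e : ∀ i, coIdeal (E i) ≃o coIdeal (F i)) (C : coIdeal A) : Set W :=
  (⋃ i, (e i (hA.part C i)).1) ∪ {z | z = y ∧ x ∈ C.1}

theorem IsPointedDecomp.glueSet_inter (hA : IsPointedDecomp A x E) (hB : IsPointedDecomp B y F)
    (e : ∀ i, coIdeal (E i) ≃o coIdeal (F i)) (C : coIdeal A) (i : ι) :
    hA.glueSet y e C ∩ F i = (e i (hA.part C i)).1 := by
  ext z
  constructor
  · rintro ⟨hz | ⟨rfl, -⟩, hzi⟩
    · obtain ⟨j, hj⟩ := Set.mem_iUnion.1 hz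
      obtain rfl : j = i := by
        by_contra hji
        exact Set.disjoint_left.1 (hB.disjoint hji) ((e j _).2.2.2 hj) hzi
      exact hj
    · exact (hB.notMem_part i hzi).elim
  · exact fun hz => ⟨Or.inl (Set.mem_iUnion_of_mem i hz), (e i _).2.2.2 hz⟩

theorem IsPointedDecomp.mem_glueSet (hA : IsPointedDecomp A x E) (hB : IsPointedDecomp B y F)
    (e : ∀ i, coIdeal (E i) ≃o coIdeal (F i)) (C : coIdeal A) :
    y ∈ hA.glueSet y e C ↔ x ∈ C.1 := by
  constructor
  · rintro (hy | ⟨-, h⟩)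
    · obtain ⟨i, hi⟩ := Set.mem_iUnion.1 hy
      exact (hB.notMem_part i ((e i _).2.2.2 hi)).elim
    · exact h
  · exact fun h => Or.inr ⟨rfl, h⟩

theorem IsPointedDecomp.glueSet_mem (hA : IsPointedDecomp A x E) (hB : IsPointedDecomp B y F)
    (e : ∀ i, coIdeal (E i) ≃o coIdeal (F i)) (C : coIdeal A) :
    hA.glueSet y e C ∈ coIdeal B := by
  have hsub : hA.glueSet y e C ⊆ B := by
    rintro z (hz | ⟨rfl, -⟩)
    · obtain ⟨i, hi⟩ := Set.mem_iUnion.1 hz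
      exact hB.part_subset i ((e i _).2.2.2 hi)
    · exact hB.mem
  suffices h : ∃ (s : Set ι) (K : Set W), s.Finite ∧ IsCompact K ∧ IsOpen K ∧
      hA.glueSet y e C = K ∪ ⋃ i ∈ s, (e i (hA.part C i)).1 by
    obtain ⟨s, K, hs, hK, hK', h⟩ := h
    refine ⟨?_, ?_, hsub⟩
    · rw [h]
      exact hK.union (hs.isCompact_biUnion fun i _ => (e i _).2.1)
    · rw [h]
      exact hK'.union (isOpen_biUnion fun i _ => (e i _).2.2.1)
  have hle (s : Set ι) : ⋃ i ∈ s, (e i (hA.part C i)).1 ⊆ hA.glueSet y e C :=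
    (Set.iUnion₂_subset_iUnion _ _).trans Set.subset_union_left
  by_cases hx : x ∈ C.1
  · have hs := hA.finite_inter (K := A \ C.1) (hA.isCompact.diff C.2.2.1) Set.sdiff_subset
      (fun h => h.2 hx)
    refine ⟨_, B \ ⋃ i ∈ {i | ((A \ C.1) ∩ E i).Nonempty}, F i, hs,
      hB.isCompact.diff (isOpen_biUnion fun i _ => hB.isOpen_part i),
      hB.isOpen.sdiff (hs.isCompact_biUnion fun i _ => hB.isCompact_part i).isClosed, ?_⟩
    apply Set.Subset.antisymm
    · intro z hz
      by_cases h : z ∈ ⋃ i ∈ {i | ((A \ C.1) ∩ E i).Nonempty}, F i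
      · obtain ⟨i, hi, hzi⟩ := Set.mem_iUnion₂.1 h
        refine Or.inr (Set.mem_iUnion₂.2 ⟨i, hi, ?_⟩)
        rw [← hA.glueSet_inter hB]
        exact ⟨hz, hzi⟩
      · exact Or.inl ⟨hsub hz, h⟩
    · refine Set.union_subset ?_ (hle _)
      rintro z ⟨hzB, hz⟩
      rcases hB.eq_or_exists hzB with rfl | ⟨i, hi⟩
      · exact (hA.mem_glueSet hB e C).2 hx
      · have hi' : ¬ ((A \ C.1) ∩ E i).Nonempty := fun h =>
          hz (Set.mem_iUnion₂.2 ⟨i, h, hi⟩)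
        have hpart : (hA.part C i).1 = E i := by
          refine Set.inter_eq_right.2 fun w hw => ?_
          by_contra hwC
          exact hi' ⟨w, ⟨hA.part_subset i hw, hwC⟩, hw⟩
        have hpart' : hA.part C i =
            ⟨E i, self_mem_coIdeal (hA.isCompact_part i) (hA.isOpen_part i)⟩ :=
          Subtype.ext hpart
        refine Or.inl (Set.mem_iUnion_of_mem i ?_)
        rw [hpart', coe_apply_self (e i) _
          (self_mem_coIdeal (hB.isCompact_part i) (hB.isOpen_part i))]
        exact hi
  · refine ⟨_, ∅, hA.finite_inter C.2.1 C.2.2.2 hx, isCompact_empty, isOpen_empty, ?_⟩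
    rw [Set.empty_union]
    refine Set.Subset.antisymm ?_ (hle _)
    rintro z (hz | ⟨-, h⟩)
    · obtain ⟨i, hi⟩ := Set.mem_iUnion.1 hz
      refine Set.mem_iUnion₂.2 ⟨i, ?_, hi⟩
      by_contra hne
      have hpart : hA.part C i = ⟨∅, empty_mem_coIdeal _⟩ :=
        Subtype.ext (Set.not_nonempty_iff_eq_empty.1 hne)
      rw [hpart, coe_apply_empty] at hi
      exact hi
    · exact (hx h).elim

theorem IsPointedDecomp.glueSet_glueSet (hA : IsPointedDecomp A x E)
    (hB : IsPointedDecomp B y F) (e : ∀ i, coIdeal (E i) ≃o coIdeal (F i)) (C : coIdeal A) :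
    hB.glueSet x (fun i => (e i).symm) ⟨hA.glueSet y e C, hA.glueSet_mem hB e C⟩ = C.1 := by
  have hpart i : hB.part ⟨hA.glueSet y e C, hA.glueSet_mem hB e C⟩ i = e i (hA.part C i) :=
    Subtype.ext (hA.glueSet_inter hB e C i)
  have hinv i : ((e i).symm (hB.part ⟨hA.glueSet y e C, hA.glueSet_mem hB e C⟩ i)).1
      = C.1 ∩ E i := by
    rw [hpart, OrderIso.symm_apply_apply]
    rfl
  ext z
  constructor
  · rintro (hz | ⟨rfl, h⟩)
    · obtain ⟨i, hi⟩ := Set.mem_iUnion.1 hz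
      exact ((hinv i).le hi).1
    · exact (hA.mem_glueSet hB e C).1 h
  · intro hz
    rcases hA.eq_or_exists (C.2.2.2 hz) with rfl | ⟨i, hi⟩
    · exact Or.inr ⟨rfl, (hA.mem_glueSet hB e C).2 hz⟩
    · exact Or.inl (Set.mem_iUnion_of_mem i ((hinv i).ge ⟨hz, hi⟩))

theorem IsPointedDecomp.glueSet_mono (hA : IsPointedDecomp A x E) (y : W)
    (e : ∀ i, coIdeal (E i) ≃o coIdeal (F i)) {C D : coIdeal A} (h : C ≤ D) :
    hA.glueSet y e C ⊆ hA.glueSet y e D := by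
  refine Set.union_subset_union (Set.iUnion_mono fun i => (e i).monotone ?_)
    fun z hz => ⟨hz.1, h hz.2⟩
  exact Set.inter_subset_inter_left (E i) h

/-- Isomorphisms of the parts of two decompositions glue. -/
theorem IsPointedDecomp.idealIso (hA : IsPointedDecomp A x E) (hB : IsPointedDecomp B y F)
    (h : ∀ i, IdealIso (E i) (F i)) : IdealIso A B := by
  let e i := (h i).some
  let φ : coIdeal A ≃ coIdeal B :=
    { toFun := fun C => ⟨hA.glueSet y e C, hA.glueSet_mem hB e C⟩
      invFun := fun C => ⟨hB.glueSet x (fun i => (e i).symm) C, hB.glueSet_mem hA _ C⟩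
      left_inv := fun C => Subtype.ext (hA.glueSet_glueSet hB e C)
      right_inv := fun C => Subtype.ext (hB.glueSet_glueSet hA (fun i => (e i).symm) C) }
  exact ⟨φ.toOrderIso (fun _ _ h => hA.glueSet_mono y e h)
    (fun _ _ h => hB.glueSet_mono x (fun i => (e i).symm) h)⟩

end Gluing

section Primitive

variable {W : Type*} [TopologicalSpace W] [T2Space W] {p q : SDiagram W} {A D U V : Set W}

/-- A compact open subset of a set of class `p` that contains a set of class `p` is a finite
disjoint union of sets of class `p`. -/
theorem PrimitiveSpace.exists_partition (hW : PrimitiveSpace W) (hA : HasClass A p)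
    (hD : IsCompact D) (hD' : IsOpen D) (hDA : D ⊆ A) (hV : HasClass V p) (hVD : V ⊆ D) :
    ∃ (κ : Type) (G : κ → Set W), Finite κ ∧ Nonempty κ ∧ (∀ k, HasClass (G k) p) ∧
      (Pairwise fun i j => Disjoint (G i) (G j)) ∧ D = ⋃ k, G k := by
  classical
  obtain ⟨n, F, hF, hd, rfl⟩ := hW D hD hD'
  choose c hc using fun i => (hF i).exists_hasClass
  have hle i : (structureDiagram W).le p (c i) :=
    hA.le_of_subset (hc i) ((Set.subset_iUnion F i).trans hDA)
  obtain ⟨i₀, -, V', hV', hV'p⟩ := hV.exists_subset_of_cover (fun i => (hc i).isCompact)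
    (fun i => (hc i).isOpen) Finset.univ (by simpa using hVD)
  have hi₀ : c i₀ = p :=
    structureDiagram_le_antisymm ((hc i₀).le_of_subset hV'p hV') (hle i₀)
  have hp : HasClass (F i₀) p := hi₀ ▸ hc i₀
  let s : Finset (Fin n) := Finset.univ.filter fun i => c i ≠ p
  have hG₀ : HasClass (F i₀ ∪ ⋃ i ∈ s, F i) p :=
    hp.union_biUnion hc hd s
      (fun i hi => (hle i).resolve_right fun h => (Finset.mem_filter.1 hi).2 h.symm)
      (fun i hi => hd fun h => (Finset.mem_filter.1 hi).2 (h ▸ hi₀))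
  have hdis (j : Fin n) (hj : c j = p) (hj₀ : j ≠ i₀) :
      Disjoint (F i₀ ∪ ⋃ i ∈ s, F i) (F j) := by
    rw [Set.disjoint_union_left]
    refine ⟨hd hj₀.symm, ?_⟩
    simp only [Set.disjoint_iUnion_left]
    exact fun i hi => hd fun h => (Finset.mem_filter.1 hi).2 (h ▸ hj)
  refine ⟨{i // c i = p}, fun j => if j.1 = i₀ then F i₀ ∪ ⋃ i ∈ s, F i else F j.1,
    inferInstance, ⟨⟨i₀, hi₀⟩⟩, ?_, ?_, ?_⟩
  · rintro ⟨j, hj⟩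
    by_cases h : j = i₀
    · simpa only [h, if_true] using hG₀
    · simpa only [h, if_false] using (hj ▸ hc j : HasClass (F j) p)
  · rintro ⟨i, hi⟩ ⟨j, hj⟩ hij
    have hij' : i ≠ j := fun h => hij (Subtype.ext h)
    by_cases h : i = i₀
    · have h' : j ≠ i₀ := fun h' => hij' (h.trans h'.symm)
      simpa only [h, h', if_true, if_false] using hdis j hj h'
    · by_cases h' : j = i₀
      · simpa only [h, h', if_true, if_false] using (hdis i hi h).symm
      · simpa only [h, h', if_false] using hd hij'
  · apply Set.Subset.antisymm
    · refine Set.iUnion_subset fun i => ?_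
      by_cases hi : c i = p
      · refine Set.Subset.trans ?_ (Set.subset_iUnion _ (⟨i, hi⟩ : {i // c i = p}))
        by_cases h : i = i₀
        · simp only [h, if_true]
          exact Set.subset_union_left
        · simp only [h, if_false]
          exact subset_rfl
      · refine Set.Subset.trans ?_ (Set.subset_iUnion _ (⟨i₀, hi₀⟩ : {i // c i = p}))
        simp only [if_true]
        exact Set.Subset.trans (Set.subset_biUnion_of_mem (u := F)
          (Finset.mem_filter.2 ⟨Finset.mem_univ i, hi⟩ : i ∈ s)) Set.subset_union_right
    · refine Set.iUnion_subset fun j => ?_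
      split_ifs
      · exact Set.union_subset (Set.subset_iUnion F _)
          (Set.iUnion₂_subset fun i _ => Set.subset_iUnion F i)
      · exact Set.subset_iUnion F _

variable [LocallyCompactSpace W] [TotallyDisconnectedSpace W] [SecondCountableTopology W]

/-- If all sets of class `p` contain two disjoint sets of class `p`, then each of them
is the union of a point and a countably infinite disjoint family of sets of class `p`. -/
theorem PrimitiveSpace.exists_isPointedDecomp (hW : PrimitiveSpace W)
    (h2 : ∀ B, HasClass B p → ∃ U V, HasClass U p ∧ HasClass V p ∧ U ⊆ B ∧ V ⊆ B ∧ Disjoint U V)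
    (hU : HasClass U p) :
    ∃ (x : W) (ι : Type) (E : ι → Set W), Countable ι ∧ Infinite ι ∧ (∀ i, HasClass (E i) p) ∧
      IsPointedDecomp U x E := by
  obtain ⟨x, hxU, hx⟩ := hU.exists_mem_block
  obtain ⟨N, hN⟩ := (nhds x).exists_antitone_basis
  have step (n : ℕ) (B : {B : Set W // HasClass B p ∧ x ∈ B}) :
      ∃ B' : {B : Set W // HasClass B p ∧ x ∈ B}, B'.1 ⊆ B.1 ∧ B'.1 ⊆ N n ∧
        ∃ V, HasClass V p ∧ V ⊆ B.1 \ B'.1 := by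
    obtain ⟨B, hB, hxB⟩ := B
    obtain ⟨V, hV, hVB, hxV⟩ : ∃ V, HasClass V p ∧ V ⊆ B ∧ x ∉ V := by
      obtain ⟨V₁, V₂, h₁, h₂, hs₁, hs₂, hd⟩ := h2 B hB
      by_cases h : x ∈ V₁
      · exact ⟨V₂, h₂, hs₂, Set.disjoint_left.1 hd h⟩
      · exact ⟨V₁, h₁, hs₁, h⟩
    obtain ⟨B', hB', hxB', hs⟩ := hx ((B \ V) ∩ N n) (Filter.inter_mem
      ((hB.isOpen.sdiff hV.isCompact.isClosed).mem_nhds ⟨hxB, hxV⟩) (hN.1.mem_of_mem trivial))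
    exact ⟨⟨B', hB', hxB'⟩, fun z hz => (hs hz).1.1, fun z hz => (hs hz).2, V, hV,
      fun z hz => ⟨hVB hz, fun hz' => (hs hz').1.2 hz⟩⟩
  choose f hf hfN T hT hTf using step
  let S : ℕ → {B : Set W // HasClass B p ∧ x ∈ B} := fun n => Nat.rec ⟨U, hU, hxU⟩ f n
  have hSanti : Antitone fun n => (S n).1 := antitone_nat_of_succ_le fun n => hf n (S n)
  have hpart n := hW.exists_partition (D := (S n).1 \ (S (n + 1)).1) (S n).2.1
    ((S n).2.1.isCompact.diff (S (n + 1)).2.1.isOpen)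
    ((S n).2.1.isOpen.sdiff (S (n + 1)).2.1.isCompact.isClosed) Set.sdiff_subset
    (hT n (S n)) (hTf n (S n))
  choose κ G hfin hne hG hd hD using hpart
  have hGS n k : G n k ⊆ (S n).1 \ (S (n + 1)).1 := by
    rw [hD n]
    exact Set.subset_iUnion (G n) k
  have hlt {m n : ℕ} (h : m < n) (k l) : Disjoint (G m k) (G n l) := by
    rw [Set.disjoint_left]
    exact fun z hz hz' => (hGS m k hz).2 (hSanti (Nat.succ_le_of_lt h) (hGS n l hz').1)
  refine ⟨x, Σ n, κ n, fun i => G i.1 i.2, inferInstance,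
    Infinite.of_injective (fun n => (⟨n, (hne n).some⟩ : Σ n, κ n))
      (fun m n h => congrArg Sigma.fst h), fun i => hG i.1 i.2, ?_⟩
  refine ⟨hU.isCompact, hU.isOpen, hxU, fun i => (hG i.1 i.2).isCompact,
    fun i => (hG i.1 i.2).isOpen, ?_, ?_⟩
  · rintro ⟨m, k⟩ ⟨n, l⟩ h
    rcases lt_trichotomy m n with hmn | rfl | hmn
    · exact hlt hmn k l
    · exact hd m fun hkl => h (congrArg (Sigma.mk m) hkl)
    · exact (hlt hmn l k).symm
  · apply Set.Subset.antisymm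
    · rintro z ⟨hzU, hzx⟩
      have hex : ∃ n, z ∉ (S n).1 := by
        obtain ⟨n, -, hn⟩ := hN.1.mem_iff.1 (isOpen_compl_singleton.mem_nhds (Ne.symm hzx))
        exact ⟨n + 1, fun hz => hn (hfN n (S n) hz) rfl⟩
      classical
      obtain ⟨n, hn⟩ : ∃ n, Nat.find hex = n + 1 := by
        refine Nat.exists_eq_succ_of_ne_zero fun h0 => ?_
        have := Nat.find_spec hex
        rw [h0] at this
        exact this hzU
      have hz : z ∈ (S n).1 \ (S (n + 1)).1 :=
        ⟨not_not.1 (Nat.find_min hex (hn ▸ n.lt_succ_self)), hn ▸ Nat.find_spec hex⟩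
      rw [hD n] at hz
      obtain ⟨k, hk⟩ := Set.mem_iUnion.1 hz
      exact Set.mem_iUnion_of_mem (⟨n, k⟩ : Σ n, κ n) hk
    · refine Set.iUnion_subset fun i z hz => ?_
      have hz' := hGS i.1 i.2 hz
      refine ⟨hSanti (Nat.zero_le i.1) hz'.1, ?_⟩
      rintro rfl
      exact hz'.2 (S (i.1 + 1)).2.2

/-- If a set of class `p` contains two disjoint sets of class `p`, then `p < p`. -/
theorem PrimitiveSpace.lt_self (hW : PrimitiveSpace W) (hA : HasClass A p) (hU : HasClass U p)
    (hV : HasClass V p) (hUA : U ⊆ A) (hVA : V ⊆ A) (hd : Disjoint U V) :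
    (structureDiagram W).lt p p := by
  obtain ⟨x, ι, E, hcount, hinf, hE, hdec⟩ := hW.exists_isPointedDecomp
    (fun B hB => hA.exists_disjoint_subsets hB hU hV hUA hVA hd) hU
  obtain ⟨σ⟩ : Nonempty (Option ι ≃ ι) := nonempty_equiv_of_countable
  refine hU.lt_of_union hV hd
    ((hdec.union hV.isCompact hV.isOpen hd).idealIso (hdec.reindex σ) fun i => ?_)
  cases i
  · exact hV.idealIso (hE _)
  · exact (hE _).idealIso (hE _)

theorem PrimitiveSpace.lt_self_of_mem_block (hW : PrimitiveSpace W) (hA : HasClass A p)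
    {x y : W} (hx : x ∈ A) (hy : y ∈ A) (hxp : x ∈ canonicalBlock W p)
    (hyp : y ∈ canonicalBlock W p) (hne : x ≠ y) : (structureDiagram W).lt p p := by
  obtain ⟨s, t, hs, ht, hxs, hyt, hst⟩ := t2_separation hne
  obtain ⟨U, hU, -, hUs⟩ := hxp (A ∩ s) ((hA.isOpen.inter hs).mem_nhds ⟨hx, hxs⟩)
  obtain ⟨V, hV, -, hVt⟩ := hyp (A ∩ t) ((hA.isOpen.inter ht).mem_nhds ⟨hy, hyt⟩)
  exact hW.lt_self hA hU hV (fun _ h => (hUs h).1) (fun _ h => (hVt h).1)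
    (hst.mono (fun _ h => (hUs h).2) (fun _ h => (hVt h).2))

theorem HasClass.exists_mem_block_of_le (hA : HasClass A p)
    (h : (structureDiagram W).le p q) : ∃ x ∈ A, x ∈ canonicalBlock W q := by
  rcases h with h | rfl
  · obtain ⟨-, V, -, hV, -, hVA, -⟩ := hA.exists_disjoint_of_lt h
    obtain ⟨x, hx, hxq⟩ := hV.exists_mem_block
    exact ⟨x, hVA hx, hxq⟩
  · exact hA.exists_mem_block

theorem PrimitiveSpace.isTrimAt_of_hasClass (hW : PrimitiveSpace W) (hA : HasClass A p) :
    IsTrimAt (structureDiagram W) (canonicalBlock W) A p := by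
  refine ⟨hA.isCompact, hA.isOpen, ?_, fun hp => ?_⟩
  · ext q
    exact ⟨fun ⟨x, hx, hxq⟩ => hA.le_of_mem_block hx hxq, hA.exists_mem_block_of_le⟩
  · obtain ⟨x, hx, hxp⟩ := hA.exists_mem_block
    refine ⟨x, ⟨hx, hxp⟩, fun y hy => ?_⟩
    by_contra hne
    exact hp (hW.lt_self_of_mem_block hA hy.1 hx hy.2 hxp hne)

theorem PrimitiveSpace.hasClass_of_isTrimAt (hW : PrimitiveSpace W)
    (hA : IsTrimAt (structureDiagram W) (canonicalBlock W) A p) : HasClass A p := by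
  classical
  obtain ⟨hc, ho, htype, huniq⟩ := hA
  obtain ⟨n, F, hF, hd, rfl⟩ := hW A hc ho
  choose c hcl using fun i => (hF i).exists_hasClass
  have hle i : (structureDiagram W).le p (c i) := by
    obtain ⟨x, hx, hxp⟩ := (hcl i).exists_mem_block
    exact htype.le ⟨x, Set.mem_iUnion_of_mem i hx, hxp⟩
  obtain ⟨x, hx, hxp⟩ : p ∈ ptype (canonicalBlock W) (⋃ i, F i) := htype.ge (Or.inr rfl)
  obtain ⟨i₀, hxi⟩ := Set.mem_iUnion.1 hx
  have hi₀ : c i₀ = p :=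
    structureDiagram_le_antisymm ((hcl i₀).le_of_mem_block hxi hxp) (hle i₀)
  have hlt i (hi : i ≠ i₀) : (structureDiagram W).lt p (c i) := by
    rcases hle i with h | h
    · exact h
    rw [← h]
    by_contra hp
    obtain ⟨y, hy, hyp⟩ := (h ▸ hcl i : HasClass (F i) p).exists_mem_block
    have hxy : x = y := (huniq hp).unique ⟨hx, hxp⟩ ⟨Set.mem_iUnion_of_mem i hy, hyp⟩
    exact Set.disjoint_left.1 (hd hi) hy (hxy ▸ hxi)
  have hall := (hi₀ ▸ hcl i₀ : HasClass (F i₀) p).union_biUnion hcl hd (Finset.univ.erase i₀)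
    (fun i hi => hlt i (Finset.ne_of_mem_erase hi))
    (fun i hi => hd (Finset.ne_of_mem_erase hi).symm)
  rw [← Finset.set_biUnion_insert, Finset.insert_erase (Finset.mem_univ _)] at hall
  simpa using hall

theorem PrimitiveSpace.isPPartition (hW : PrimitiveSpace W) :
    IsPPartition (structureDiagram W) (canonicalBlock W) := by
  have heq {p q : SDiagram W} {w : W} (hp : w ∈ canonicalBlock W p)
      (hq : w ∈ canonicalBlock W q) : p = q := by
    obtain ⟨A, hA, hwA, -⟩ := hp Set.univ Filter.univ_mem
    obtain ⟨B, hB, hwB, -⟩ := hq Set.univ Filter.univ_mem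
    exact structureDiagram_le_antisymm (hA.le_of_mem_block hwA hq) (hB.le_of_mem_block hwB hp)
  refine ⟨fun p => ?_, fun p q hpq => ?_, fun p => ?_⟩
  · obtain ⟨A, hA⟩ := exists_hasClass p
    obtain ⟨x, -, hx⟩ := hA.exists_mem_block
    exact ⟨x, hx⟩
  · exact Set.disjoint_left.2 fun w hp hq => hpq (heq hp hq)
  · ext w
    simp only [Set.mem_inter_iff, mem_derivedSet, accPt_iff_nhds, Set.mem_iUnion,
      Set.mem_ofPred_eq, exists_prop]
    constructor
    · rintro ⟨hacc, q, hq⟩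
      refine ⟨q, ?_, hq⟩
      obtain ⟨A, hA, hwA, -⟩ := hq Set.univ Filter.univ_mem
      obtain ⟨y, ⟨hyA, hyp⟩, hyw⟩ := hacc A (hA.isOpen.mem_nhds hwA)
      rcases hA.le_of_mem_block hyA hyp with h | rfl
      · exact h
      · exact hW.lt_self_of_mem_block hA hyA hwA hyp hq hyw
    · rintro ⟨q, hqp, hq⟩
      refine ⟨fun N hN => ?_, q, hq⟩
      obtain ⟨A, hA, hwA, hAN⟩ := hq N hN
      by_cases h : q = p
      · subst h
        obtain ⟨U, V, hU, hV, hUA, hVA, hUV⟩ := hA.exists_disjoint_of_lt hqp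
        obtain ⟨x, hx, hxq⟩ := hU.exists_mem_block
        obtain ⟨y, hy, hyq⟩ := hV.exists_mem_block
        by_cases hxw : x = w
        · refine ⟨y, ⟨hAN (hVA hy), hyq⟩, ?_⟩
          rintro rfl
          exact Set.disjoint_left.1 hUV hx (hxw ▸ hy)
        · exact ⟨x, ⟨hAN (hUA hx), hxq⟩, hxw⟩
      · obtain ⟨y, hy, hyp⟩ := hA.exists_mem_block_of_le (Or.inl hqp)
        refine ⟨y, ⟨hAN hy, hyp⟩, ?_⟩
        rintro rfl
        exact h (heq hq hyp)

end Primitive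

/-- The canonical partition `𝒳(W)` of a primitive ω-Stone space `W` is a trim
`𝒮(W)`-partition, its trim sets are exactly the PI compact open sets, and a compact open set
`A` is `p`-trim iff `[A] = p`. -/
theorem canonical_partition_trim {W : Type u}
    [TopologicalSpace W] [SecondCountableTopology W] [LocallyCompactSpace W]
    [T2Space W] [TotallyDisconnectedSpace W]
    (hW : PrimitiveSpace W) :
    IsTrimPartition (structureDiagram W) (canonicalBlock W) ∧
      (∀ A : Set W, IsTrimSet (structureDiagram W) (canonicalBlock W) A ↔ IsPISet A) ∧
      (∀ A : Set W, IsCompact A → IsOpen A → ∀ p : SDiagram W,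
        IsTrimAt (structureDiagram W) (canonicalBlock W) A p ↔ HasClass A p) := by
  refine ⟨⟨hW.isPPartition, fun w U hU => ?_, fun p _ w hw U hU => ?_, fun p w hw => ?_⟩,
    fun A => ⟨fun ⟨_, h⟩ => (hW.hasClass_of_isTrimAt h).isPISet, fun h => ?_⟩,
    fun A _ _ p => ⟨hW.hasClass_of_isTrimAt, hW.isTrimAt_of_hasClass⟩⟩
  · obtain ⟨V, hc, ho, hwV, hVU⟩ := exists_isCompact_isOpen_subset hU
    obtain ⟨n, F, hF, -, rfl⟩ := hW V hc ho
    obtain ⟨i, hi⟩ := Set.mem_iUnion.1 hwV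
    obtain ⟨p, hp⟩ := (hF i).exists_hasClass
    exact ⟨F i, ⟨p, hW.isTrimAt_of_hasClass hp⟩, hi, (Set.subset_iUnion F i).trans hVU⟩
  · obtain ⟨A, hA, hwA, hAU⟩ := hw U hU
    exact ⟨A, hW.hasClass_of_isTrimAt hA, hwA, hAU⟩
  · obtain ⟨A, hA, hwA, -⟩ := hw Set.univ Filter.univ_mem
    exact ⟨A, hW.isTrimAt_of_hasClass hA, hwA⟩
  · obtain ⟨p, hp⟩ := h.exists_hasClass
    exact ⟨p, hW.isTrimAt_of_hasClass hp⟩
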